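/- Let Λ_C be a free ℤ-module of finite rank with a negative-definite quadratic form q₀ taking integer values on Λ_C, let Λ = ℤ ⊕ ℤ ⊕ Λ_C ⊕ ℤ ⊕ ℤ with q(a₁,a₂,λ,d₂,d₁) = a₁d₁ + a₂d₂ + q₀(λ), polar form ⟨·,·⟩, dual lattice Λ^∨ := {x ∈ Λ⊗ℚ : ⟨x,y⟩ ∈ ℤ for all y ∈ Λ} = ℤ ⊕ ℤ ⊕ Λ_C^∨ ⊕ ℤ ⊕ ℤ, and let Γ be the group of ℚ-linear automorphisms of Λ⊗ℚ of determinant 1 preserving q with γ(Λ) = Λ. Let 𝒞 ⊆ Λ_C ⊗ ℚ be any set such that every element of Λ_C^∨ differs from an element of 𝒞 by an element of Λ_C. Write b₂ = (1,0,0,0,0) and b₋₂ = (0,0,0,0,1). Then for every primitive λ ∈ Λ^∨ there exist γ ∈ Γ, s ∈ ℤ and v ∈ 𝒞 such that γ·λ = b₂ + v + s·b₋₂. -/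

import Mathlib

/-- `Λ ⊗ ℚ` for `Λ = ℤ ⊕ ℤ ⊕ ℤᵐ ⊕ ℤ ⊕ ℤ`: coordinates `(a₁, a₂, λ, d₂, d₁)`. -/
abbrev Qv (m : ℕ) : Type := ℚ × ℚ × (Fin m → ℚ) × ℚ × ℚ

/-- The quadratic form `q(a₁,a₂,λ,d₂,d₁) = a₁d₁ + a₂d₂ + q₀(λ)`. -/
def bigQ {m : ℕ} (q₀ : QuadraticForm ℚ (Fin m → ℚ)) (x : Qv m) : ℚ :=
  x.1 * x.2.2.2.2 + x.2.1 * x.2.2.2.1 + q₀ x.2.2.1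

/-- The lattice `Λ = ℤ ⊕ ℤ ⊕ Λ_C ⊕ ℤ ⊕ ℤ` inside `Λ ⊗ ℚ`, as the `ℤ`-span of the
standard basis vectors. -/
def latticeL (m : ℕ) : Submodule ℤ (Qv m) :=
  Submodule.span ℤ
    ({((1 : ℚ), (0 : ℚ), (0 : Fin m → ℚ), (0 : ℚ), (0 : ℚ)),
      ((0 : ℚ), (1 : ℚ), (0 : Fin m → ℚ), (0 : ℚ), (0 : ℚ)),
      ((0 : ℚ), (0 : ℚ), (0 : Fin m → ℚ), (1 : ℚ), (0 : ℚ)),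
      ((0 : ℚ), (0 : ℚ), (0 : Fin m → ℚ), (0 : ℚ), (1 : ℚ))} ∪
      Set.range (fun i : Fin m =>
        ((0 : ℚ), (0 : ℚ), Pi.single i (1 : ℚ), (0 : ℚ), (0 : ℚ))))

/-- The lattice `Λ_C = ℤᵐ` inside `Λ_C ⊗ ℚ = ℚᵐ`. -/
def latticeLC (m : ℕ) : Submodule ℤ (Fin m → ℚ) :=
  Submodule.span ℤ (Set.range fun i : Fin m => (Pi.single i (1 : ℚ) : Fin m → ℚ))

/-- The dual lattice `Λ^∨ = {x : ⟨x,y⟩ ∈ ℤ for all y ∈ Λ}` with respect to the polar form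
of `q`. -/
def dualL (m : ℕ) (q₀ : QuadraticForm ℚ (Fin m → ℚ)) : Set (Qv m) :=
  {x | ∀ y ∈ latticeL m, ∃ k : ℤ, QuadraticMap.polar (bigQ q₀) x y = (k : ℚ)}

/-- The dual lattice `Λ_C^∨` of `Λ_C` with respect to the polar form of `q₀`. -/
def dualLC (m : ℕ) (q₀ : QuadraticForm ℚ (Fin m → ℚ)) : Set (Fin m → ℚ) :=
  {x | ∀ y ∈ latticeLC m, ∃ k : ℤ, QuadraticMap.polar (⇑q₀) x y = (k : ℚ)}

section Eichler

open QuadraticMap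

variable {V : Type*} [AddCommGroup V] [Module ℚ V]

/-- The group of determinant-one isometries of `Q` preserving the lattice `L`. -/
def specialLatticeIsometries (Q : QuadraticForm ℚ V) (L : Submodule ℤ V) :
    Subgroup (V ≃ₗ[ℚ] V) where
  carrier := {γ | LinearEquiv.det γ = 1 ∧ (∀ x, Q (γ x) = Q x) ∧ ∀ x, γ x ∈ L ↔ x ∈ L}
  mul_mem' := by
    rintro γ δ ⟨h₁, h₂, h₃⟩ ⟨k₁, k₂, k₃⟩
    refine ⟨by simp [h₁, k₁], fun x => ?_, fun x => ?_⟩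
    · rw [LinearEquiv.mul_apply, h₂, k₂]
    · rw [LinearEquiv.mul_apply, h₃, k₃]
  one_mem' := ⟨by simp, fun _ => rfl, fun _ => Iff.rfl⟩
  inv_mem' := by
    rintro γ ⟨h₁, h₂, h₃⟩
    have h (x : V) : γ (γ⁻¹ x) = x := γ.apply_symm_apply x
    refine ⟨by simp [h₁], fun x => ?_, fun x => ?_⟩
    · rw [← h₂, h]
    · rw [← h₃, h]

/-- Two vectors are related if an element of `specialLatticeIsometries Q L` maps one to the
other. -/
def LatticeEquivalent (Q : QuadraticForm ℚ V) (L : Submodule ℤ V) (x y : V) : Prop :=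
  ∃ γ ∈ specialLatticeIsometries Q L, γ x = y

/-- All pairings of `x` with vectors of `L` are integral multiples of `k`. -/
def PairingsDivisibleBy (Q : QuadraticForm ℚ V) (L : Submodule ℤ V) (k : ℤ) (x : V) : Prop :=
  ∀ y ∈ L, ∃ j : ℤ, polar Q x y = k * j

variable {Q : QuadraticForm ℚ V} {L : Submodule ℤ V}

theorem LatticeEquivalent.refl (x : V) : LatticeEquivalent Q L x x :=
  ⟨1, one_mem _, rfl⟩

theorem LatticeEquivalent.trans {x y z : V} (h : LatticeEquivalent Q L x y)
    (h' : LatticeEquivalent Q L y z) : LatticeEquivalent Q L x z := by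
  obtain ⟨γ, hγ, rfl⟩ := h
  obtain ⟨δ, hδ, rfl⟩ := h'
  exact ⟨δ * γ, mul_mem hδ hγ, rfl⟩

theorem PairingsDivisibleBy.of_latticeEquivalent {k : ℤ} {x y : V}
    (hx : PairingsDivisibleBy Q L k x) (h : LatticeEquivalent Q L x y) :
    PairingsDivisibleBy Q L k y := by
  obtain ⟨γ, hγ, rfl⟩ := h
  intro z hz
  have hγz : γ (γ⁻¹ z) = z := γ.apply_symm_apply z
  obtain ⟨j, hj⟩ := hx (γ⁻¹ z) (((inv_mem hγ).2.2 z).2 hz)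
  refine ⟨j, ?_⟩
  rw [← hj, ← hγz]
  simp only [polar, ← map_add, hγ.2.1]
  rw [hγz]

theorem LatticeEquivalent.symm {x y : V} (h : LatticeEquivalent Q L x y) :
    LatticeEquivalent Q L y x := by
  obtain ⟨γ, hγ, rfl⟩ := h
  exact ⟨γ⁻¹, inv_mem hγ, γ.symm_apply_apply x⟩

/-- The Eichler transvection attached to an isotropic vector `e` and a vector `a` orthogonal
to `e`. -/
def eichlerTransvection (Q : QuadraticForm ℚ V) {e a : V} (he : Q e = 0)
    (hea : polar Q e a = 0) : V ≃ₗ[ℚ] V :=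
  LinearEquiv.transvection (f := polarBilin Q a) (v := -e)
      (by simp [polar_neg_right, polar_comm Q a e, hea]) *
    LinearEquiv.transvection (f := polarBilin Q e) (v := a + Q a • e)
      (by simp [polar_add_right, polar_smul_right, polar_self, he, hea])

theorem eichlerTransvection_apply {e a : V} (he : Q e = 0) (hea : polar Q e a = 0) (x : V) :
    eichlerTransvection Q he hea x =
      x - polar Q a x • e + polar Q e x • (a - Q a • e) := by
  rw [eichlerTransvection, LinearEquiv.mul_apply, LinearEquiv.transvection.apply,
    LinearEquiv.transvection.apply]
  simp only [polarBilin_apply_apply, polar_add_right, polar_smul_right, polar_self,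
    polar_comm Q a e, hea, smul_eq_mul]
  module

theorem map_eichlerTransvection {e a : V} (he : Q e = 0) (hea : polar Q e a = 0) (x : V) :
    Q (eichlerTransvection Q he hea x) = Q x := by
  have hs (c : ℚ) (v : V) : Q (c • v) = c * c * Q v := by simp [QuadraticMap.map_smul]
  have h₁ : eichlerTransvection Q he hea x =
      x + (polar Q e x • a + (-polar Q a x - polar Q e x * Q a) • e) := by
    rw [eichlerTransvection_apply]; module
  rw [h₁, QuadraticMap.map_add Q x, QuadraticMap.map_add Q (_ • a), hs, hs]
  simp only [polar_add_right, polar_smul_right, polar_smul_left, polar_comm Q a e, he, hea,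
    polar_comm Q x a, polar_comm Q x e, smul_eq_mul]
  ring

theorem eichlerTransvection_mem_lattice {e a : V} (he : Q e = 0) (hea : polar Q e a = 0)
    (hL : ∀ x ∈ L, ∃ k : ℤ, Q x = k) (heL : e ∈ L) (haL : a ∈ L) {x : V} (hx : x ∈ L) :
    eichlerTransvection Q he hea x ∈ L := by
  have hp {y z : V} (hy : y ∈ L) (hz : z ∈ L) : ∃ k : ℤ, polar Q y z = k := by
    obtain ⟨k₁, h₁⟩ := hL _ (add_mem hy hz)
    obtain ⟨k₂, h₂⟩ := hL _ hy
    obtain ⟨k₃, h₃⟩ := hL _ hz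
    exact ⟨k₁ - k₂ - k₃, by simp [polar, h₁, h₂, h₃]⟩
  obtain ⟨i, hi⟩ := hp haL hx
  obtain ⟨j, hj⟩ := hp heL hx
  obtain ⟨k, hk⟩ := hL a haL
  rw [eichlerTransvection_apply, hi, hj, hk]
  simp only [Int.cast_smul_eq_zsmul]
  exact add_mem (sub_mem hx (L.smul_mem _ heL))
    (L.smul_mem _ (sub_mem haL (L.smul_mem _ heL)))

theorem eichlerTransvection_mem {e a : V} (he : Q e = 0) (hea : polar Q e a = 0)
    (hL : ∀ x ∈ L, ∃ k : ℤ, Q x = k) (heL : e ∈ L) (haL : a ∈ L) :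
    eichlerTransvection Q he hea ∈ specialLatticeIsometries Q L := by
  refine ⟨by simp [eichlerTransvection], map_eichlerTransvection he hea, fun x => ⟨fun h => ?_,
    eichlerTransvection_mem_lattice he hea hL heL haL⟩⟩
  have hea' : polar Q e (-a) = 0 := by simp [polar_neg_right, hea]
  have hinv : eichlerTransvection Q he hea' (eichlerTransvection Q he hea x) = x := by
    simp only [eichlerTransvection_apply, polar_add_right, polar_smul_right, polar_sub_right,
      polar_neg_left, polar_self, he, hea, polar_comm Q a e, smul_eq_mul, QuadraticMap.map_neg]
    module
  rw [← hinv]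
  exact eichlerTransvection_mem_lattice he hea' hL heL (neg_mem haL) h

theorem LatticeEquivalent.of_eichler {x y : V} (e a : V) (he : Q e = 0) (hea : polar Q e a = 0)
    (hL : ∀ x ∈ L, ∃ k : ℤ, Q x = k) (heL : e ∈ L) (haL : a ∈ L)
    (hy : y = x - polar Q a x • e + polar Q e x • (a - Q a • e)) : LatticeEquivalent Q L x y :=
  ⟨_, eichlerTransvection_mem he hea hL heL haL, by rw [eichlerTransvection_apply, hy]⟩

end Eichler

section TwoHyperbolicPlanes

open QuadraticMap

variable {m : ℕ} {q₀ : QuadraticForm ℚ (Fin m → ℚ)}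

theorem polar_bigQ (q₀ : QuadraticForm ℚ (Fin m → ℚ)) (x y : Qv m) :
    polar (bigQ q₀) x y = x.1 * y.2.2.2.2 + y.1 * x.2.2.2.2 + x.2.1 * y.2.2.2.1
      + y.2.1 * x.2.2.2.1 + polar q₀ x.2.2.1 y.2.2.1 := by
  simp only [polar, bigQ, Prod.fst_add, Prod.snd_add]
  ring

/-- `bigQ` as a bundled quadratic form. -/
def bigQForm (q₀ : QuadraticForm ℚ (Fin m → ℚ)) : QuadraticForm ℚ (Qv m) :=
  QuadraticMap.ofPolar (bigQ q₀)
    (fun c x => by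
      simp only [bigQ, Prod.smul_fst, Prod.smul_snd, smul_eq_mul, QuadraticMap.map_smul]
      ring)
    (fun x x' y => by
      simp only [polar_bigQ, Prod.fst_add, Prod.snd_add, polar_add_left]
      ring)
    (fun c x y => by
      simp only [polar_bigQ, Prod.smul_fst, Prod.smul_snd, smul_eq_mul, polar_smul_left]
      ring)

theorem coe_bigQForm (q₀ : QuadraticForm ℚ (Fin m → ℚ)) : ⇑(bigQForm q₀) = bigQ q₀ := rfl

theorem mem_latticeL_of_mem_latticeLC {u : Fin m → ℚ} (hu : u ∈ latticeLC m) :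
    ((0, 0, u, 0, 0) : Qv m) ∈ latticeL m := by
  induction hu using Submodule.span_induction with
  | mem x hx =>
    obtain ⟨i, rfl⟩ := hx
    exact Submodule.subset_span (Or.inr ⟨i, rfl⟩)
  | zero => exact zero_mem _
  | add x y _ _ hx hy => simpa using add_mem hx hy
  | smul c x _ hx => simpa using (latticeL m).smul_mem c hx

theorem mem_latticeL_iff {x : Qv m} :
    x ∈ latticeL m ↔ ∃ (a₁ a₂ d₂ d₁ : ℤ) (u : Fin m → ℚ), u ∈ latticeLC m ∧
      x = ((a₁ : ℚ), (a₂ : ℚ), u, (d₂ : ℚ), (d₁ : ℚ)) := by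
  constructor
  · intro hx
    induction hx using Submodule.span_induction with
    | mem x hx =>
      rcases hx with (rfl | rfl | rfl | rfl) | ⟨i, rfl⟩
      · exact ⟨1, 0, 0, 0, 0, zero_mem _, by simp⟩
      · exact ⟨0, 1, 0, 0, 0, zero_mem _, by simp⟩
      · exact ⟨0, 0, 1, 0, 0, zero_mem _, by simp⟩
      · exact ⟨0, 0, 0, 1, 0, zero_mem _, by simp⟩
      · exact ⟨0, 0, 0, 0, _, Submodule.subset_span ⟨i, rfl⟩, by simp⟩
    | zero => exact ⟨0, 0, 0, 0, 0, zero_mem _, by simp; rfl⟩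
    | add x y _ _ hx hy =>
      obtain ⟨a₁, a₂, d₂, d₁, u, hu, rfl⟩ := hx
      obtain ⟨a₁', a₂', d₂', d₁', u', hu', rfl⟩ := hy
      exact ⟨a₁ + a₁', a₂ + a₂', d₂ + d₂', d₁ + d₁', u + u', add_mem hu hu', by simp⟩
    | smul c x _ hx =>
      obtain ⟨a₁, a₂, d₂, d₁, u, hu, rfl⟩ := hx
      exact ⟨c * a₁, c * a₂, c * d₂, c * d₁, c • u, Submodule.smul_mem _ c hu, by simp⟩
  · rintro ⟨a₁, a₂, d₂, d₁, u, hu, rfl⟩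
    have h₁ : ((1, 0, 0, 0, 0) : Qv m) ∈ latticeL m := Submodule.subset_span (by simp)
    have h₂ : ((0, 1, 0, 0, 0) : Qv m) ∈ latticeL m := Submodule.subset_span (by simp)
    have h₃ : ((0, 0, 0, 1, 0) : Qv m) ∈ latticeL m := Submodule.subset_span (by simp)
    have h₄ : ((0, 0, 0, 0, 1) : Qv m) ∈ latticeL m := Submodule.subset_span (by simp)
    have h := add_mem (add_mem (add_mem (add_mem ((latticeL m).smul_mem a₁ h₁)
      ((latticeL m).smul_mem a₂ h₂)) ((latticeL m).smul_mem d₂ h₃))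
      ((latticeL m).smul_mem d₁ h₄)) (mem_latticeL_of_mem_latticeLC hu)
    simpa using h

theorem bigQForm_integral (hint : ∀ x ∈ latticeLC m, ∃ k : ℤ, q₀ x = (k : ℚ)) :
    ∀ x ∈ latticeL m, ∃ k : ℤ, bigQForm q₀ x = k := by
  intro x hx
  obtain ⟨a₁, a₂, d₂, d₁, u, hu, rfl⟩ := mem_latticeL_iff.1 hx
  obtain ⟨k, hk⟩ := hint u hu
  exact ⟨a₁ * d₁ + a₂ * d₂ + k, by simp [coe_bigQForm, bigQ, hk]⟩

theorem pairingsDivisibleBy_bigQForm_iff {k : ℤ} {x : Qv m} :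
    PairingsDivisibleBy (bigQForm q₀) (latticeL m) k x ↔
      ∃ a₁ a₂ d₂ d₁ : ℤ, ∃ v : Fin m → ℚ, x = ((k * a₁ : ℚ), (k * a₂ : ℚ), v, (k * d₂ : ℚ),
        (k * d₁ : ℚ)) ∧ PairingsDivisibleBy q₀ (latticeLC m) k v := by
  constructor
  · intro h
    obtain ⟨a₁, a₂, v, d₂, d₁⟩ := x
    have h' (b₁ b₂ c₂ c₁ : ℤ) (u : Fin m → ℚ) (hu : u ∈ latticeLC m) :=
      h _ (mem_latticeL_iff.2 ⟨b₁, b₂, c₂, c₁, u, hu, rfl⟩)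
    simp only [coe_bigQForm, polar_bigQ] at h'
    obtain ⟨j₁, hj₁⟩ := h' 0 0 0 1 0 (zero_mem _)
    obtain ⟨j₂, hj₂⟩ := h' 0 0 1 0 0 (zero_mem _)
    obtain ⟨i₂, hi₂⟩ := h' 0 1 0 0 0 (zero_mem _)
    obtain ⟨i₁, hi₁⟩ := h' 1 0 0 0 0 (zero_mem _)
    refine ⟨j₁, j₂, i₂, i₁, v, ?_, fun u hu => ?_⟩
    · simp [polar_zero_right] at hj₁ hj₂ hi₂ hi₁
      simp [hj₁, hj₂, hi₂, hi₁]
    · simpa using h' 0 0 0 0 u hu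
  · rintro ⟨a₁, a₂, d₂, d₁, v, rfl, hv⟩ y hy
    obtain ⟨b₁, b₂, c₂, c₁, u, hu, rfl⟩ := mem_latticeL_iff.1 hy
    obtain ⟨j, hj⟩ := hv u hu
    refine ⟨a₁ * c₁ + b₁ * d₁ + a₂ * c₂ + b₂ * d₂ + j, ?_⟩
    simp only [coe_bigQForm, polar_bigQ, hj]
    push_cast
    ring

theorem latticeEquivalent_shear_fst_snd
    (hint : ∀ x ∈ latticeLC m, ∃ k : ℤ, q₀ x = (k : ℚ))
    (t a₁ a₂ d₂ d₁ : ℤ) (v : Fin m → ℚ) :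
    LatticeEquivalent (bigQForm q₀) (latticeL m) (a₁, a₂, v, d₂, d₁)
      ((a₁ : ℚ), ((a₂ + t * a₁ : ℤ) : ℚ), v, (d₂ : ℚ), ((d₁ - t * d₂ : ℤ) : ℚ)) := by
  refine .of_eichler (0, 1, 0, 0, 0) (0, 0, 0, 0, -t) ?_ ?_ (bigQForm_integral hint)
    (mem_latticeL_iff.2 ⟨0, 1, 0, 0, 0, zero_mem _, by simp⟩)
    (mem_latticeL_iff.2 ⟨0, 0, 0, -t, 0, zero_mem _, by simp⟩) ?_
  all_goals simp [coe_bigQForm, polar_bigQ, bigQ, polar_zero_left, sub_eq_add_neg, mul_comm]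

theorem latticeEquivalent_shear_snd_fst
    (hint : ∀ x ∈ latticeLC m, ∃ k : ℤ, q₀ x = (k : ℚ))
    (t a₁ a₂ d₂ d₁ : ℤ) (v : Fin m → ℚ) :
    LatticeEquivalent (bigQForm q₀) (latticeL m) (a₁, a₂, v, d₂, d₁)
      (((a₁ + t * a₂ : ℤ) : ℚ), (a₂ : ℚ), v, ((d₂ - t * d₁ : ℤ) : ℚ), (d₁ : ℚ)) := by
  refine .of_eichler (1, 0, 0, 0, 0) (0, 0, 0, -t, 0) ?_ ?_ (bigQForm_integral hint)
    (mem_latticeL_iff.2 ⟨1, 0, 0, 0, 0, zero_mem _, by simp⟩)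
    (mem_latticeL_iff.2 ⟨0, 0, -t, 0, 0, zero_mem _, by simp⟩) ?_
  all_goals simp [coe_bigQForm, polar_bigQ, bigQ, polar_zero_left, sub_eq_add_neg, mul_comm]

theorem latticeEquivalent_shear_fst_third
    (hint : ∀ x ∈ latticeLC m, ∃ k : ℤ, q₀ x = (k : ℚ))
    (t a₁ a₂ d₂ d₁ : ℤ) (v : Fin m → ℚ) :
    LatticeEquivalent (bigQForm q₀) (latticeL m) (a₁, a₂, v, d₂, d₁)
      ((a₁ : ℚ), (a₂ : ℚ), v, ((d₂ + t * a₁ : ℤ) : ℚ), ((d₁ - t * a₂ : ℤ) : ℚ)) := by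
  refine .of_eichler (0, 0, 0, 1, 0) (0, 0, 0, 0, -t) ?_ ?_ (bigQForm_integral hint)
    (mem_latticeL_iff.2 ⟨0, 0, 1, 0, 0, zero_mem _, by simp⟩)
    (mem_latticeL_iff.2 ⟨0, 0, 0, -t, 0, zero_mem _, by simp⟩) ?_
  all_goals simp [coe_bigQForm, polar_bigQ, bigQ, polar_zero_left, sub_eq_add_neg, mul_comm]

theorem latticeEquivalent_shear_third_fst
    (hint : ∀ x ∈ latticeLC m, ∃ k : ℤ, q₀ x = (k : ℚ))
    (t a₁ a₂ d₂ d₁ : ℤ) (v : Fin m → ℚ) :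
    LatticeEquivalent (bigQForm q₀) (latticeL m) (a₁, a₂, v, d₂, d₁)
      (((a₁ + t * d₂ : ℤ) : ℚ), ((a₂ - t * d₁ : ℤ) : ℚ), v, (d₂ : ℚ), (d₁ : ℚ)) := by
  refine .of_eichler (1, 0, 0, 0, 0) (0, -t, 0, 0, 0) ?_ ?_ (bigQForm_integral hint)
    (mem_latticeL_iff.2 ⟨1, 0, 0, 0, 0, zero_mem _, by simp⟩)
    (mem_latticeL_iff.2 ⟨0, -t, 0, 0, 0, zero_mem _, by simp⟩) ?_
  all_goals simp [coe_bigQForm, polar_bigQ, bigQ, polar_zero_left, sub_eq_add_neg, mul_comm]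

theorem latticeEquivalent_swap_snd
    (hint : ∀ x ∈ latticeLC m, ∃ k : ℤ, q₀ x = (k : ℚ))
    (a₁ a₂ d₂ d₁ : ℤ) (v : Fin m → ℚ) :
    LatticeEquivalent (bigQForm q₀) (latticeL m) (a₁, a₂, v, d₂, d₁)
      ((a₂ : ℚ), ((-a₁ : ℤ) : ℚ), v, ((-d₁ : ℤ) : ℚ), (d₂ : ℚ)) := by
  convert! ((latticeEquivalent_shear_snd_fst hint 1 a₁ a₂ d₂ d₁ v).trans
    (latticeEquivalent_shear_fst_snd hint (-1) _ _ _ _ v)).trans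
    (latticeEquivalent_shear_snd_fst hint 1 _ _ _ _ v) using 3 <;> push_cast <;> ring_nf

theorem latticeEquivalent_swap_third
    (hint : ∀ x ∈ latticeLC m, ∃ k : ℤ, q₀ x = (k : ℚ))
    (a₁ a₂ d₂ d₁ : ℤ) (v : Fin m → ℚ) :
    LatticeEquivalent (bigQForm q₀) (latticeL m) (a₁, a₂, v, d₂, d₁)
      ((d₂ : ℚ), ((-d₁ : ℤ) : ℚ), v, ((-a₁ : ℤ) : ℚ), (a₂ : ℚ)) := by
  convert! ((latticeEquivalent_shear_third_fst hint 1 a₁ a₂ d₂ d₁ v).trans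
    (latticeEquivalent_shear_fst_third hint (-1) _ _ _ _ v)).trans
    (latticeEquivalent_shear_third_fst hint 1 _ _ _ _ v) using 3 <;> push_cast <;> ring_nf

theorem latticeEquivalent_neg_planes
    (hint : ∀ x ∈ latticeLC m, ∃ k : ℤ, q₀ x = (k : ℚ))
    (a₁ a₂ d₂ d₁ : ℤ) (v : Fin m → ℚ) :
    LatticeEquivalent (bigQForm q₀) (latticeL m) (a₁, a₂, v, d₂, d₁)
      (((-a₁ : ℤ) : ℚ), ((-a₂ : ℤ) : ℚ), v, ((-d₂ : ℤ) : ℚ), ((-d₁ : ℤ) : ℚ)) :=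
  (latticeEquivalent_swap_snd hint a₁ a₂ d₂ d₁ v).trans
    (latticeEquivalent_swap_snd hint _ _ _ _ v)

theorem latticeEquivalent_pairing_snd
    (hint : ∀ x ∈ latticeLC m, ∃ k : ℤ, q₀ x = (k : ℚ))
    {u v : Fin m → ℚ} (hu : u ∈ latticeLC m) (a₁ d₁ : ℚ) :
    LatticeEquivalent (bigQForm q₀) (latticeL m) (a₁, 0, v, 0, d₁)
      (a₁, polar q₀ v u, v, 0, d₁) := by
  refine .of_eichler (0, 1, 0, 0, 0) (0, 0, -u, 0, 0) ?_ ?_ (bigQForm_integral hint)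
    (mem_latticeL_iff.2 ⟨0, 1, 0, 0, 0, zero_mem _, by simp⟩)
    (mem_latticeL_of_mem_latticeLC (neg_mem hu)) ?_
  all_goals
    simp [coe_bigQForm, polar_bigQ, bigQ, polar_zero_left, polar_neg_left, polar_comm q₀ u]

theorem latticeEquivalent_translate
    (hint : ∀ x ∈ latticeLC m, ∃ k : ℤ, q₀ x = (k : ℚ))
    {u v : Fin m → ℚ} (hu : u ∈ latticeLC m) (d₁ : ℚ) :
    LatticeEquivalent (bigQForm q₀) (latticeL m) (1, 0, v, 0, d₁)
      (1, 0, v + u, 0, d₁ - polar q₀ v u - q₀ u) := by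
  refine .of_eichler (0, 0, 0, 0, 1) (0, 0, u, 0, 0) ?_ ?_ (bigQForm_integral hint)
    (mem_latticeL_iff.2 ⟨0, 0, 0, 1, 0, zero_mem _, by simp⟩)
    (mem_latticeL_of_mem_latticeLC hu) ?_
  all_goals
    simp [coe_bigQForm, polar_bigQ, bigQ, polar_zero_left, polar_comm q₀ u, sub_eq_add_neg]

/-- A vector whose first coordinate is nonzero and minimal in absolute value along its
equivalence class has all its pairings divisible by that coordinate. -/
theorem exists_latticeEquivalent_of_minimal
    (hint : ∀ x ∈ latticeLC m, ∃ k : ℤ, q₀ x = (k : ℚ))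
    {a : ℤ} (ha : a ≠ 0) {x : Qv m}
    (hx : PairingsDivisibleBy (bigQForm q₀) (latticeL m) 1 x) (hxa : x.1 = a)
    (hmin : ∀ (y : Qv m) (b : ℤ), LatticeEquivalent (bigQForm q₀) (latticeL m) x y →
      y.1 = b → b ≠ 0 → a.natAbs ≤ b.natAbs) :
    PairingsDivisibleBy (bigQForm q₀) (latticeL m) a x ∧ ∃ (d : ℤ) (v : Fin m → ℚ),
      LatticeEquivalent (bigQForm q₀) (latticeL m) x ((a : ℚ), 0, v, 0, (d : ℚ)) := by
  have hdvd_snd (a₂ d₂ d₁ : ℤ) (v : Fin m → ℚ)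
      (h : LatticeEquivalent (bigQForm q₀) (latticeL m) x (a, a₂, v, d₂, d₁)) : a ∣ a₂ := by
    by_contra hna
    have h' := (h.trans (latticeEquivalent_shear_fst_snd hint (-(a₂ / a)) _ _ _ _ v)).trans
      (latticeEquivalent_swap_snd hint _ _ _ _ v)
    have hmod : a₂ + -(a₂ / a) * a = a₂ % a := by
      rw [Int.emod_def]; ring
    rw [hmod] at h'
    have hle := hmin _ _ h' rfl (fun h0 => hna (Int.dvd_of_emod_eq_zero h0))
    have hlt := Int.emod_lt_abs a₂ ha
    rw [Int.abs_eq_natAbs] at hlt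
    have hnn := Int.emod_nonneg a₂ ha
    omega
  have hdvd_third (a₂ d₂ d₁ : ℤ) (v : Fin m → ℚ)
      (h : LatticeEquivalent (bigQForm q₀) (latticeL m) x (a, a₂, v, d₂, d₁)) : a ∣ d₂ := by
    by_contra hna
    have h' := (h.trans (latticeEquivalent_shear_fst_third hint (-(d₂ / a)) _ _ _ _ v)).trans
      (latticeEquivalent_swap_third hint _ _ _ _ v)
    have hmod : d₂ + -(d₂ / a) * a = d₂ % a := by
      rw [Int.emod_def]; ring
    rw [hmod] at h'
    have hle := hmin _ _ h' rfl (fun h0 => hna (Int.dvd_of_emod_eq_zero h0))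
    have hlt := Int.emod_lt_abs d₂ ha
    rw [Int.abs_eq_natAbs] at hlt
    have hnn := Int.emod_nonneg d₂ ha
    omega
  obtain ⟨a₁, a₂, d₂, d₁, v, rfl, hv⟩ := pairingsDivisibleBy_bigQForm_iff.1 hx
  simp only [Int.cast_one, one_mul] at *
  obtain rfl : a₁ = a := by exact_mod_cast hxa
  obtain ⟨i, rfl⟩ := hdvd_snd _ _ _ _ (.refl _)
  obtain ⟨j, rfl⟩ := hdvd_third _ _ _ _ (.refl _)
  obtain ⟨d, hd⟩ : ∃ d : ℤ, LatticeEquivalent (bigQForm q₀) (latticeL m)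
      (a₁, (a₁ * i : ℤ), v, (a₁ * j : ℤ), d₁) ((a₁ : ℚ), 0, v, 0, (d : ℚ)) := by
    have h := (latticeEquivalent_shear_fst_snd hint (-i) a₁ (a₁ * i) (a₁ * j) d₁ v).trans
      (latticeEquivalent_shear_fst_third hint (-j) _ _ _ _ v)
    rw [show a₁ * i + -i * a₁ = 0 by ring, show a₁ * j + -j * a₁ = 0 by ring] at h
    exact ⟨_, by simpa only [Int.cast_zero] using h⟩
  refine ⟨?_, d, v, hd⟩
  have hd' : LatticeEquivalent (bigQForm q₀) (latticeL m)
      (a₁, (a₁ * i : ℤ), v, (a₁ * j : ℤ), d₁) (a₁, (0 : ℤ), v, (0 : ℤ), d) := by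
    simpa using hd
  refine PairingsDivisibleBy.of_latticeEquivalent ?_ hd.symm
  obtain ⟨c, rfl⟩ : a₁ ∣ d := by
    have h := hd'.trans (latticeEquivalent_shear_third_fst hint (-1) a₁ 0 0 d v)
    exact hdvd_snd d 0 d v (by simpa using h)
  refine pairingsDivisibleBy_bigQForm_iff.2 ⟨1, 0, 0, c, v, by simp, fun u hu => ?_⟩
  obtain ⟨k, hk⟩ := hv u hu
  simp only [Int.cast_one, one_mul] at hk
  have h := hd.trans (latticeEquivalent_pairing_snd hint (v := v) hu _ _)
  rw [hk] at h
  obtain ⟨l, rfl⟩ := hdvd_snd k 0 (a₁ * c) v (by simpa using h)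
  exact ⟨l, by rw [hk]; push_cast; rfl⟩

/-- If every vector equivalent to `x` has first coordinate zero, then `x` pairs to zero with
the whole lattice. -/
theorem pairingsDivisibleBy_zero_of_forall_fst_eq_zero
    (hint : ∀ x ∈ latticeLC m, ∃ k : ℤ, q₀ x = (k : ℚ))
    {x : Qv m}
    (hx : PairingsDivisibleBy (bigQForm q₀) (latticeL m) 1 x)
    (h0 : ∀ y : Qv m, LatticeEquivalent (bigQForm q₀) (latticeL m) x y → y.1 = 0) :
    PairingsDivisibleBy (bigQForm q₀) (latticeL m) 0 x := by
  obtain ⟨a₁, a₂, d₂, d₁, v, rfl, hv⟩ := pairingsDivisibleBy_bigQForm_iff.1 hx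
  simp only [Int.cast_one, one_mul] at *
  obtain rfl : a₁ = 0 := Int.cast_eq_zero.1 (h0 _ (.refl _))
  obtain rfl : a₂ = 0 :=
    Int.cast_eq_zero.1 (h0 _ (latticeEquivalent_swap_snd hint _ _ _ _ v))
  obtain rfl : d₂ = 0 :=
    Int.cast_eq_zero.1 (h0 _ (latticeEquivalent_swap_third hint _ _ _ _ v))
  obtain rfl : d₁ = 0 := by
    have h := h0 _ ((latticeEquivalent_shear_third_fst hint (-1) 0 0 0 d₁ v).trans
      (latticeEquivalent_swap_snd hint _ _ _ _ v))
    simpa using h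
  refine pairingsDivisibleBy_bigQForm_iff.2 ⟨0, 0, 0, 0, v, by simp, fun u hu => ?_⟩
  obtain ⟨k, hk⟩ := hv u hu
  simp only [Int.cast_one, one_mul] at hk
  have h := latticeEquivalent_pairing_snd hint (v := v) hu 0 0
  rw [hk] at h
  have h' := h0 _ ((show LatticeEquivalent (bigQForm q₀) (latticeL m) _
    (((0 : ℤ) : ℚ), (k : ℚ), v, ((0 : ℤ) : ℚ), ((0 : ℤ) : ℚ)) by simpa using h).trans
      (latticeEquivalent_swap_snd hint _ _ _ _ v))
  exact ⟨0, by rw [hk]; simpa using h'⟩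

theorem exists_latticeEquivalent_one_zero
    (hint : ∀ x ∈ latticeLC m, ∃ k : ℤ, q₀ x = (k : ℚ))
    {x : Qv m}
    (hx : PairingsDivisibleBy (bigQForm q₀) (latticeL m) 1 x)
    (hprim : ∀ k : ℤ, PairingsDivisibleBy (bigQForm q₀) (latticeL m) k x → k = 1 ∨ k = -1) :
    ∃ (d : ℤ) (v : Fin m → ℚ),
      LatticeEquivalent (bigQForm q₀) (latticeL m) x (1, 0, v, 0, (d : ℚ)) := by
  classical
  have hex : ∃ n : ℕ, ∃ (y : Qv m) (a : ℤ), LatticeEquivalent (bigQForm q₀) (latticeL m) x y ∧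
      y.1 = a ∧ a ≠ 0 ∧ a.natAbs = n := by
    by_contra hne
    have h := hprim 0 (pairingsDivisibleBy_zero_of_forall_fst_eq_zero hint hx fun y hy => by
      obtain ⟨a₁, a₂, d₂, d₁, v, rfl, -⟩ :=
        pairingsDivisibleBy_bigQForm_iff.1 (hx.of_latticeEquivalent hy)
      by_contra ha
      exact hne ⟨_, _, a₁, hy, by simp, fun h => ha (by simp [h]), rfl⟩)
    omega
  obtain ⟨y, a, hxy, hya, ha, hn⟩ := Nat.find_spec hex
  obtain ⟨hdvd, d, v, hyv⟩ := exists_latticeEquivalent_of_minimal hint ha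
    (hx.of_latticeEquivalent hxy) hya fun z b hz hzb hb =>
      hn ▸ Nat.find_min' hex ⟨z, b, hxy.trans hz, hzb, hb, rfl⟩
  rcases hprim a (hdvd.of_latticeEquivalent hxy.symm) with rfl | rfl
  · exact ⟨d, v, by simpa using hxy.trans hyv⟩
  · have h : LatticeEquivalent (bigQForm q₀) (latticeL m) x
        (((-1 : ℤ) : ℚ), ((0 : ℤ) : ℚ), v, ((0 : ℤ) : ℚ), (d : ℚ)) := by
      simpa using hxy.trans hyv
    exact ⟨-d, v, by simpa using h.trans (latticeEquivalent_neg_planes hint _ _ _ _ v)⟩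

theorem eq_one_or_neg_one_of_pairingsDivisibleBy {x : Qv m}
    (hprim : ∀ (k : ℤ) (μ : Qv m), μ ∈ dualL m q₀ → x = k • μ → k = 1 ∨ k = -1) {k : ℤ}
    (hk : PairingsDivisibleBy (bigQForm q₀) (latticeL m) k x) : k = 1 ∨ k = -1 := by
  have key (n : ℤ) (hn : n ≠ 0) (h : PairingsDivisibleBy (bigQForm q₀) (latticeL m) n x) :
      n = 1 ∨ n = -1 := by
    have hn' : (n : ℚ) ≠ 0 := Int.cast_ne_zero.2 hn
    refine hprim n ((n : ℚ)⁻¹ • x) (fun y hy => ?_) ?_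
    · obtain ⟨j, hj⟩ := h y hy
      refine ⟨j, ?_⟩
      rw [← coe_bigQForm, polar_smul_left, hj, smul_eq_mul, inv_mul_cancel_left₀ hn']
    · rw [← Int.cast_smul_eq_zsmul ℚ, smul_inv_smul₀ hn']
  rcases eq_or_ne k 0 with rfl | hk0
  · have h := key 2 two_ne_zero fun y hy => ⟨0, by
      obtain ⟨j, hj⟩ := hk y hy
      simpa using hj⟩
    omega
  · exact key k hk0 hk

end TwoHyperbolicPlanes

/-- Every primitive element `λ` of the dual lattice `Λ^∨` can be moved, by an element `γ` of
the group of determinant-one `ℚ`-linear automorphisms preserving `q` and the lattice `Λ`,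
to a vector of the form `b₂ + v + s·b₋₂` with `s ∈ ℤ` and `v ∈ 𝒞`, where `𝒞` is any set of
representatives for `Λ_C^∨` modulo `Λ_C`. -/
theorem stmt15 (m : ℕ) (q₀ : QuadraticForm ℚ (Fin m → ℚ))
    (hneg : ∀ x : Fin m → ℚ, x ≠ 0 → q₀ x < 0)
    (hint : ∀ x ∈ latticeLC m, ∃ k : ℤ, q₀ x = (k : ℚ))
    (𝒞 : Set (Fin m → ℚ))
    (h𝒞 : ∀ x ∈ dualLC m q₀, ∃ v ∈ 𝒞, x - v ∈ latticeLC m)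
    (lam : Qv m) (hlam : lam ∈ dualL m q₀) (hne : lam ≠ 0)
    (hprim : ∀ (k : ℤ) (μ : Qv m), μ ∈ dualL m q₀ → lam = k • μ → k = 1 ∨ k = -1) :
    ∃ γ : Qv m ≃ₗ[ℚ] Qv m,
      LinearMap.det (γ : Qv m →ₗ[ℚ] Qv m) = 1 ∧
      (∀ x, bigQ q₀ (γ x) = bigQ q₀ x) ∧
      ⇑γ '' (latticeL m : Set (Qv m)) = (latticeL m : Set (Qv m)) ∧
      ∃ (s : ℤ) (v : Fin m → ℚ), v ∈ 𝒞 ∧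
        γ lam = ((1 : ℚ), (0 : ℚ), (0 : Fin m → ℚ), (0 : ℚ), (0 : ℚ))
              + ((0 : ℚ), (0 : ℚ), v, (0 : ℚ), (0 : ℚ))
              + s • ((0 : ℚ), (0 : ℚ), (0 : Fin m → ℚ), (0 : ℚ), (1 : ℚ)) := by
  have hdual : PairingsDivisibleBy (bigQForm q₀) (latticeL m) 1 lam := fun y hy => by
    obtain ⟨k, hk⟩ := hlam y hy
    exact ⟨k, by rw [coe_bigQForm, hk]; simp⟩
  obtain ⟨d, v, hv⟩ := exists_latticeEquivalent_one_zero hint hdual fun k hk =>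
    eq_one_or_neg_one_of_pairingsDivisibleBy hprim hk
  have hvdual : v ∈ dualLC m q₀ := fun u hu => by
    obtain ⟨k, hk⟩ := hdual.of_latticeEquivalent hv _ (mem_latticeL_of_mem_latticeLC hu)
    exact ⟨k, by simpa [coe_bigQForm, polar_bigQ] using hk⟩
  obtain ⟨w, hw, hvw⟩ := h𝒞 v hvdual
  have hwv : w - v ∈ latticeLC m := by simpa using neg_mem hvw
  obtain ⟨k, hk⟩ := hvdual _ hwv
  obtain ⟨l, hl⟩ := hint _ hwv
  obtain ⟨γ, ⟨hdet, hiso, hmem⟩, hγ⟩ := hv.trans (latticeEquivalent_translate hint hwv d)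
  refine ⟨γ, by simpa using congrArg Units.val hdet, hiso, ?_, d - k - l, w, hw, ?_⟩
  · ext x
    refine ⟨?_, fun hx => ⟨γ.symm x, (hmem _).1 (by simpa using hx), by simp⟩⟩
    rintro ⟨y, hy, rfl⟩
    exact (hmem y).2 hy
  · rw [hγ, hk, hl]
    simp
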